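/- arXiv:1310.7686 — 2 statements merged into one kernel-verified Lean document; each statement's English description precedes it below -/
import Mathlib

section
/- Let β be real with 0 < β ≤ 1, let k ≥ 1 and 0 ≤ l < l' be integers, and let T, T' > 0 satisfy λ̃_k(β,T) = μ̃_l(β,T) and λ̃_k(β,T') = μ̃_{l'}(β,T'). Then T < T'. (That is, the intersection time T_{k,l}(β) is strictly increasing in l.) -/
open Real

/-- The hyperbolic cotangent. -/
noncomputable def coth (t : ℝ) : ℝ := Real.cosh t / Real.sinh t

/-- The normalized Steklov eigenvalues `λ̃_n(β,T)` (for `n ≥ 1`). -/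
noncomputable def lamS (n : ℕ) (β T : ℝ) : ℝ :=
  (4 * n * π / β) * (coth (n * T) - Real.sqrt ((coth (n * T)) ^ 2 - β))

/-- The normalized Steklov eigenvalues `μ̃_n(β,T)` (with `μ̃_0(β,T) = 8π/(Tβ)`). -/
noncomputable def muS (n : ℕ) (β T : ℝ) : ℝ :=
  if n = 0 then 8 * π / (T * β)
  else (4 * n * π / β) * (coth (n * T) + Real.sqrt ((coth (n * T)) ^ 2 - β))

theorem coth_le_coth {x y : ℝ} (hx : 0 < x) (hxy : x ≤ y) : coth y ≤ coth x := by
  have hsx := Real.sinh_pos_iff.2 hx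
  have hsy := Real.sinh_pos_iff.2 (hx.trans_le hxy)
  have h := Real.sinh_nonneg_iff.2 (sub_nonneg.2 hxy)
  rw [Real.sinh_sub] at h
  unfold coth
  rw [div_le_div_iff₀ hsy hsx]
  linarith

theorem coth_sq_eq {x : ℝ} (hx : 0 < x) : coth x ^ 2 = 1 + (1 / Real.sinh x) ^ 2 := by
  have hs := Real.sinh_pos_iff.2 hx
  unfold coth
  field_simp
  linarith [Real.cosh_sq x]

theorem one_lt_coth {x : ℝ} (hx : 0 < x) : 1 < coth x := by
  unfold coth
  rw [one_lt_div (Real.sinh_pos_iff.2 hx)]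
  exact Real.sinh_lt_cosh x

theorem coth_add_inv_sinh {x : ℝ} (hx : 0 < x) :
    coth x + 1 / Real.sinh x = coth (x / 2) := by
  have hs : 0 < Real.sinh (x / 2) := Real.sinh_pos_iff.2 (by linarith)
  have hc := Real.cosh_pos (x / 2)
  have h1 : Real.sinh x = 2 * Real.sinh (x / 2) * Real.cosh (x / 2) := by
    rw [← Real.sinh_two_mul]; ring_nf
  have h2 : Real.cosh x = Real.cosh (x / 2) ^ 2 + Real.sinh (x / 2) ^ 2 := by
    rw [← Real.cosh_two_mul]; ring_nf
  unfold coth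
  rw [h1, h2]
  field_simp
  linarith [Real.cosh_sq (x / 2)]

theorem sinh_lt_self_mul_cosh {x : ℝ} (hx : 0 < x) : Real.sinh x < x * Real.cosh x := by
  have hmono : StrictMonoOn (fun t : ℝ => t * Real.cosh t - Real.sinh t) (Set.Ici 0) := by
    refine strictMonoOn_of_hasDerivWithinAt_pos (f' := fun t => t * Real.sinh t)
      (convex_Ici 0) (by fun_prop) (fun t _ => ?_) (fun t ht => ?_)
    · have h := ((hasDerivAt_id t).mul (Real.hasDerivAt_cosh t)).sub (Real.hasDerivAt_sinh t)
      refine HasDerivAt.hasDerivWithinAt (h.congr_deriv ?_)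
      simp
    · rw [interior_Ici] at ht
      exact mul_pos ht (Real.sinh_pos_iff.2 ht)
  have h := hmono (Set.mem_Ici.2 le_rfl) (Set.mem_Ici.2 hx.le) hx
  simp only [Real.sinh_zero] at h
  linarith

theorem one_lt_self_mul_coth {x : ℝ} (hx : 0 < x) : 1 < x * coth x := by
  unfold coth
  rw [← mul_div_assoc, one_lt_div (Real.sinh_pos_iff.2 hx)]
  exact sinh_lt_self_mul_cosh hx

theorem strictMonoOn_self_mul_coth : StrictMonoOn (fun x : ℝ => x * coth x) (Set.Ioi 0) := by
  have hd : ∀ t ∈ Set.Ioi (0 : ℝ), HasDerivAt (fun x : ℝ => x * coth x)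
      ((Real.sinh t * Real.cosh t - t) / Real.sinh t ^ 2) t := by
    intro t ht
    have hs := Real.sinh_pos_iff.2 ht
    have h := (hasDerivAt_id t).mul
      ((Real.hasDerivAt_cosh t).div (Real.hasDerivAt_sinh t) hs.ne')
    refine h.congr_deriv ?_
    simp only [id, Pi.div_apply]
    field_simp
    linear_combination (-t) * Real.cosh_sq t
  refine strictMonoOn_of_hasDerivWithinAt_pos (convex_Ioi 0)
    (fun t ht => (hd t ht).continuousAt.continuousWithinAt)
    (fun t ht => (hd t (interior_subset ht)).hasDerivWithinAt) (fun t ht => ?_)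
  have ht0 : 0 < t := interior_subset ht
  have hs := Real.sinh_pos_iff.2 ht0
  have h1 : t < Real.sinh t := Real.self_lt_sinh_iff.2 ht0
  have h2 := Real.one_le_cosh t
  exact div_pos (by nlinarith) (by positivity)

theorem antitoneOn_self_div_sinh : AntitoneOn (fun x : ℝ => x / Real.sinh x) (Set.Ioi 0) := by
  have hd : ∀ t ∈ Set.Ioi (0 : ℝ), HasDerivAt (fun x : ℝ => x / Real.sinh x)
      ((Real.sinh t - t * Real.cosh t) / Real.sinh t ^ 2) t := by
    intro t ht
    have h := (hasDerivAt_id t).div (Real.hasDerivAt_sinh t) (Real.sinh_pos_iff.2 ht).ne'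
    refine h.congr_deriv ?_
    simp
  refine antitoneOn_of_hasDerivWithinAt_nonpos (convex_Ioi 0)
    (fun t ht => (hd t ht).continuousAt.continuousWithinAt)
    (fun t ht => (hd t (interior_subset ht)).hasDerivWithinAt) (fun t ht => ?_)
  have h := sinh_lt_self_mul_cosh (interior_subset ht : 0 < t)
  exact div_nonpos_of_nonpos_of_nonneg (by linarith) (by positivity)

theorem inv_sinh_le_sqrt {β x : ℝ} (hβ1 : β ≤ 1) (hx : 0 < x) :
    1 / Real.sinh x ≤ √(coth x ^ 2 - β) := by
  apply Real.le_sqrt_of_sq_le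
  rw [coth_sq_eq hx]
  linarith

theorem strictMonoOn_self_mul_coth_add_sqrt {β : ℝ} (hβ1 : β ≤ 1) :
    StrictMonoOn (fun x : ℝ => x * (coth x + √(coth x ^ 2 - β))) (Set.Ioi 0) := by
  intro x hx y hy hxy
  have hx0 : 0 < x := hx
  have hy0 : 0 < y := hy
  have hA : x * coth (x / 2) < y * coth (y / 2) := by
    have h := strictMonoOn_self_mul_coth (Set.mem_Ioi.2 (half_pos hx0))
      (Set.mem_Ioi.2 (half_pos hy0)) (by linarith)
    simp only at h
    linarith
  rw [← coth_add_inv_sinh hx0, ← coth_add_inv_sinh hy0] at hA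
  have hr : y / Real.sinh y ≤ x / Real.sinh x := antitoneOn_self_div_sinh hx hy hxy.le
  have hS : ∀ t : ℝ, 0 < t →
      (t * √(coth t ^ 2 - β)) ^ 2 = (t / Real.sinh t) ^ 2 + (1 - β) * t ^ 2 := by
    intro t ht
    rw [mul_pow, Real.sq_sqrt (by nlinarith [one_lt_coth ht]), coth_sq_eq ht]
    ring
  have hSx := hS x hx0
  have hSy := hS y hy0
  have hle : y / Real.sinh y ≤ y * √(coth y ^ 2 - β) := by
    have h := mul_le_mul_of_nonneg_left (inv_sinh_le_sqrt hβ1 hy0) hy0.le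
    rwa [mul_one_div] at h
  have hry : 0 < y / Real.sinh y := div_pos hy0 (Real.sinh_pos_iff.2 hy0)
  have hsq : (1 - β) * x ^ 2 ≤ (1 - β) * y ^ 2 :=
    mul_le_mul_of_nonneg_left (by gcongr) (by linarith)
  rw [mul_add, mul_add, mul_one_div, mul_one_div] at hA
  simp only [mul_add]
  generalize x * √(coth x ^ 2 - β) = Sx at *
  generalize y * √(coth y ^ 2 - β) = Sy at *
  generalize x / Real.sinh x = rx at *
  generalize y / Real.sinh y = ry at *
  have hS' : Sx ≤ Sy + (rx - ry) := by
    refine le_of_abs_le (abs_le_of_sq_le_sq ?_ (by linarith))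
    nlinarith [mul_le_mul_of_nonneg_right hle (sub_nonneg.2 hr)]
  linarith

theorem coth_add_sqrt_antitone {β x y : ℝ} (hx : 0 < x) (hxy : x ≤ y) :
    coth y + √(coth y ^ 2 - β) ≤ coth x + √(coth x ^ 2 - β) := by
  have h := coth_le_coth hx hxy
  have h1 := one_lt_coth (hx.trans_le hxy)
  have : coth y ^ 2 ≤ coth x ^ 2 := by gcongr
  gcongr

theorem coth_sub_sqrt_monotone {β x y : ℝ} (hβ : 0 < β) (hβ1 : β ≤ 1) (hx : 0 < x)
    (hxy : x ≤ y) :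
    coth x - √(coth x ^ 2 - β) ≤ coth y - √(coth y ^ 2 - β) := by
  have heq : ∀ t : ℝ, 0 < t →
      coth t - √(coth t ^ 2 - β) = β / (coth t + √(coth t ^ 2 - β)) := by
    intro t ht
    have h1 := one_lt_coth ht
    have h2 := Real.sqrt_nonneg (coth t ^ 2 - β)
    rw [eq_div_iff (by linarith)]
    have h3 := Real.sq_sqrt (show 0 ≤ coth t ^ 2 - β by nlinarith)
    linarith
  have hy := hx.trans_le hxy
  rw [heq x hx, heq y hy]
  have h1 := one_lt_coth hy
  have h2 := Real.sqrt_nonneg (coth y ^ 2 - β)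
  exact div_le_div_of_nonneg_left hβ.le (by linarith) (coth_add_sqrt_antitone hx hxy)

theorem lamS_monotone {β T T' : ℝ} {k : ℕ} (hβ : 0 < β) (hβ1 : β ≤ 1) (hk : 1 ≤ k)
    (hT : 0 < T) (hTT' : T ≤ T') : lamS k β T ≤ lamS k β T' := by
  have hk0 : (0 : ℝ) < k := by exact_mod_cast hk
  unfold lamS
  exact mul_le_mul_of_nonneg_left
    (coth_sub_sqrt_monotone hβ hβ1 (by positivity) (by gcongr)) (by positivity)

theorem muS_antitone {β T T' : ℝ} {n : ℕ} (hβ : 0 < β) (hn : n ≠ 0)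
    (hT : 0 < T) (hTT' : T ≤ T') : muS n β T' ≤ muS n β T := by
  have hn0 : (0 : ℝ) < n := by exact_mod_cast Nat.pos_of_ne_zero hn
  unfold muS
  rw [if_neg hn, if_neg hn]
  exact mul_le_mul_of_nonneg_left
    (coth_add_sqrt_antitone (by positivity) (by gcongr)) (by positivity)

theorem muS_lt_muS {β T : ℝ} {l l' : ℕ} (hβ : 0 < β) (hβ1 : β ≤ 1) (hT : 0 < T)
    (hll' : l < l') : muS l β T < muS l' β T := by
  have hmu : ∀ n : ℕ, n ≠ 0 → muS n β T =
      4 * π / (β * T) * (n * T * (coth (n * T) + √(coth (n * T) ^ 2 - β))) := by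
    intro n hn
    rw [muS, if_neg hn]
    field_simp
  have hl'0 : (0 : ℝ) < l' := by exact_mod_cast (Nat.zero_le l).trans_lt hll'
  have hx : 0 < l' * T := by positivity
  rw [hmu l' (by omega)]
  rcases Nat.eq_zero_or_pos l with rfl | hl
  · have h0 : muS 0 β T = 4 * π / (β * T) * 2 := by
      rw [muS, if_pos rfl]
      field_simp
      norm_num
    rw [h0]
    refine mul_lt_mul_of_pos_left ?_ (by positivity)
    have h1 := one_lt_self_mul_coth (half_pos hx)
    rw [← coth_add_inv_sinh hx] at h1
    have h2 := mul_le_mul_of_nonneg_left (inv_sinh_le_sqrt hβ1 hx) hx.le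
    linarith
  · have hl0 : (0 : ℝ) < l := by exact_mod_cast hl
    rw [hmu l hl.ne']
    refine mul_lt_mul_of_pos_left ?_ (by positivity)
    have hlt : (l : ℝ) * T < l' * T := by gcongr
    exact strictMonoOn_self_mul_coth_add_sqrt hβ1 (Set.mem_Ioi.2 (by positivity))
      (Set.mem_Ioi.2 hx) hlt

theorem intersection_time_increasing_in_l (β : ℝ) (hβ : 0 < β) (hβ1 : β ≤ 1)
    (k l l' : ℕ) (hk : 1 ≤ k) (hll' : l < l') (T T' : ℝ) (hT : 0 < T) (hT' : 0 < T')
    (h : lamS k β T = muS l β T) (h' : lamS k β T' = muS l' β T') :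
    T < T' := by
  by_contra! hle
  have h1 := lamS_monotone hβ hβ1 hk hT' hle
  have h2 := muS_lt_muS hβ hβ1 hT hll'
  have h3 := muS_antitone hβ (by omega : l' ≠ 0) hT' hle
  linarith
end

section
/- Let k > l ≥ 0 be integers and let α > 1 be real with β = 4α/(1+α)² (so 0 < β < 1); if l ≥ 1 assume α < k/l. Suppose T > 0 satisfies λ̃_k(β,T) = μ̃_l(β,T) and T' > 0 satisfies λ̃_k(1,T') = μ̃_l(1,T'). Then λ̃_k(β,T) < λ̃_k(1,T'). -/
open Real

lemma one_lt_coth_s13 {t : ℝ} (ht : 0 < t) : 1 < coth t := by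
  rw [coth, one_lt_div (Real.sinh_pos_iff.2 ht)]
  exact Real.sinh_lt_cosh t

lemma log_coth_add_one_div_coth_sub_one {t : ℝ} (ht : 0 < t) :
    log ((coth t + 1) / (coth t - 1)) = 2 * t := by
  have hs : 0 < Real.sinh t := Real.sinh_pos_iff.2 ht
  have hd : 0 < Real.cosh t - Real.sinh t := sub_pos.2 (Real.sinh_lt_cosh t)
  have h : (coth t + 1) / (coth t - 1)
      = (Real.cosh t + Real.sinh t) / (Real.cosh t - Real.sinh t) := by
    unfold coth
    field_simp
  rw [h, Real.cosh_add_sinh, Real.cosh_sub_sinh, ← Real.exp_sub, Real.log_exp]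
  ring

/-- The function `u ↦ artanh (u / κ) / κ`. -/
noncomputable def lowerBranch (κ u : ℝ) : ℝ := (log (κ + u) - log (κ - u)) / (2 * κ)

/-- The function `u ↦ artanh (ν / u) / ν`, extended by `1 / u` at `ν = 0`. -/
noncomputable def upperBranch (ν u : ℝ) : ℝ :=
  if ν = 0 then 1 / u else (log (u + ν) - log (u - ν)) / (2 * ν)

/-- The difference of the two branch functions. -/
noncomputable def branchGap (ν κ u : ℝ) : ℝ := lowerBranch κ u - upperBranch ν u

lemma hasDerivAt_lowerBranch {κ u : ℝ} (hu : 0 < u) (huκ : u < κ) :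
    HasDerivAt (lowerBranch κ) (1 / (κ ^ 2 - u ^ 2)) u := by
  have h₁ : κ + u ≠ 0 := by linarith
  have h₂ : κ - u ≠ 0 := by linarith
  have hκ : κ ≠ 0 := by linarith
  have h₃ : κ ^ 2 - u ^ 2 ≠ 0 := by
    rw [show κ ^ 2 - u ^ 2 = (κ + u) * (κ - u) by ring]
    exact mul_ne_zero h₁ h₂
  have h := ((((hasDerivAt_id u).const_add κ).log h₁).sub
    (((hasDerivAt_id u).const_sub κ).log h₂)).div_const (2 * κ)
  refine h.congr_deriv ?_
  simp only [id]
  field_simp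
  ring

lemma hasDerivAt_upperBranch {ν u : ℝ} (hν : 0 ≤ ν) (hu : ν < u) :
    HasDerivAt (upperBranch ν) (-(1 / (u ^ 2 - ν ^ 2))) u := by
  have hu0 : u ≠ 0 := by linarith
  by_cases h0 : ν = 0
  · have h : upperBranch ν = fun u => u⁻¹ := by
      funext v
      simp [upperBranch, h0]
    rw [h]
    refine (hasDerivAt_inv hu0).congr_deriv ?_
    rw [h0]
    simp
  · have h : upperBranch ν = fun u => (log (u + ν) - log (u - ν)) / (2 * ν) := by
      funext v
      simp [upperBranch, h0]
    have h₁ : u + ν ≠ 0 := by linarith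
    have h₂ : u - ν ≠ 0 := by linarith
    have h₃ : u ^ 2 - ν ^ 2 ≠ 0 := by
      rw [show u ^ 2 - ν ^ 2 = (u + ν) * (u - ν) by ring]
      exact mul_ne_zero h₁ h₂
    rw [h]
    have h := ((((hasDerivAt_id u).add_const ν).log h₁).sub
      (((hasDerivAt_id u).sub_const ν).log h₂)).div_const (2 * ν)
    refine h.congr_deriv ?_
    simp only [id]
    field_simp
    ring

lemma hasDerivAt_branchGap {ν κ u : ℝ} (hν : 0 ≤ ν) (hu : ν < u) (huκ : u < κ) :
    HasDerivAt (branchGap ν κ) (1 / (κ ^ 2 - u ^ 2) + 1 / (u ^ 2 - ν ^ 2)) u :=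
  ((hasDerivAt_lowerBranch (hν.trans_lt hu) huκ).sub
    (hasDerivAt_upperBranch hν hu)).congr_deriv (by ring)

lemma strictMonoOn_branchGap {ν κ : ℝ} (hν : 0 ≤ ν) :
    StrictMonoOn (branchGap ν κ) (Set.Ioo ν κ) := by
  refine strictMonoOn_of_deriv_pos (convex_Ioo ν κ)
    (fun u hu => (hasDerivAt_branchGap hν hu.1 hu.2).continuousAt.continuousWithinAt) ?_
  intro u hu
  rw [interior_Ioo] at hu
  rw [(hasDerivAt_branchGap hν hu.1 hu.2).deriv]
  have h₁ : 0 < κ ^ 2 - u ^ 2 := by nlinarith [hu.1, hu.2]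
  have h₂ : 0 < u ^ 2 - ν ^ 2 := by nlinarith [hu.1, hu.2]
  positivity

/-- The gap is nonpositive at the quadratic mean of the endpoints. -/
lemma branchGap_nonpos_of_sq {ν κ m : ℝ} (hν : 0 ≤ ν) (hm : ν < m) (hmκ : m < κ)
    (hsq : 2 * m ^ 2 = κ ^ 2 + ν ^ 2) : branchGap ν κ m ≤ 0 := by
  have hm0 : 0 < m := hν.trans_lt hm
  have hκ : 0 < κ := hm0.trans hmκ
  have hprod : log (κ + m) + log (κ - m) = log (m + ν) + log (m - ν) := by
    rw [← Real.log_mul (by linarith) (by linarith), ← Real.log_mul (by linarith) (by linarith)]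
    congr 1
    linarith
  have hdiff : log (κ + m) - log (m + ν) ≤ (κ - ν) / (m + ν) := by
    rw [← Real.log_div (by linarith) (by linarith)]
    refine (Real.log_le_sub_one_of_pos (by apply div_pos <;> linarith)).trans_eq ?_
    field_simp
    ring
  rw [branchGap, sub_nonpos, lowerBranch, upperBranch]
  split_ifs with h0
  · subst h0
    rw [div_le_div_iff₀ (by positivity) hm0]
    simp only [add_zero, sub_zero] at hprod hdiff
    have : (log (κ + m) - log m) * m ≤ κ := (le_div_iff₀ hm0).1 hdiff
    have heq : log (κ + m) - log (κ - m) = 2 * (log (κ + m) - log m) := by linarith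
    rw [heq]
    linarith
  · have hν' : 0 < ν := lt_of_le_of_ne hν (Ne.symm h0)
    have hlow : 2 * ν / (m + ν) ≤ log (m + ν) - log (m - ν) := by
      have h := Real.log_le_sub_one_of_pos
        (show 0 < (m - ν) / (m + ν) by apply div_pos <;> linarith)
      rw [Real.log_div (by linarith) (by linarith)] at h
      have e : (m - ν) / (m + ν) - 1 = -(2 * ν / (m + ν)) := by
        field_simp
        ring
      linarith
    have e₁ : ν * ((κ - ν) / (m + ν)) * 2 = (κ - ν) * (2 * ν / (m + ν)) := by ring
    have h₁ := mul_le_mul_of_nonneg_left hdiff hν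
    have h₂ := mul_le_mul_of_nonneg_left hlow (show 0 ≤ κ - ν by linarith)
    rw [div_le_div_iff₀ (by positivity) (by positivity)]
    have heq : log (κ + m) - log (κ - m)
        = 2 * (log (κ + m) - log (m + ν)) + (log (m + ν) - log (m - ν)) := by linarith
    rw [heq]
    nlinarith

/-- Above the quadratic mean, the gap is strictly midpoint convex. -/
lemma two_mul_branchGap_lt {ν κ s δ : ℝ} (hν : 0 ≤ ν) (hδ : 0 < δ) (h₁ : ν < s - δ)
    (h₂ : s + δ < κ) (hsq : κ ^ 2 + ν ^ 2 ≤ 2 * s ^ 2) :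
    2 * branchGap ν κ s < branchGap ν κ (s - δ) + branchGap ν κ (s + δ) := by
  have hderiv : ∀ t ∈ Set.Icc 0 δ,
      HasDerivAt (fun t => branchGap ν κ (s - t) + branchGap ν κ (s + t))
        (-(1 / (κ ^ 2 - (s - t) ^ 2) + 1 / ((s - t) ^ 2 - ν ^ 2))
          + (1 / (κ ^ 2 - (s + t) ^ 2) + 1 / ((s + t) ^ 2 - ν ^ 2))) t := by
    intro t ht
    have ha := (hasDerivAt_branchGap (κ := κ) (u := s - t) hν
      (by linarith [ht.2]) (by linarith [ht.1])).comp_const_sub s t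
    have hb := (hasDerivAt_branchGap (κ := κ) (u := s + t) hν
      (by linarith [ht.1]) (by linarith [ht.2])).comp_const_add s t
    exact ha.add hb
  have hmono : StrictMonoOn (fun t => branchGap ν κ (s - t) + branchGap ν κ (s + t))
      (Set.Icc 0 δ) := by
    refine strictMonoOn_of_deriv_pos (convex_Icc 0 δ)
      (fun t ht => (hderiv t ht).continuousAt.continuousWithinAt) ?_
    intro t ht
    rw [interior_Icc] at ht
    rw [(hderiv t ⟨ht.1.le, ht.2.le⟩).deriv]
    obtain ⟨ht0, htδ⟩ := ht
    have hx : ν < s - t := by linarith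
    have hy : s + t < κ := by linarith
    have p₁ : 0 < κ ^ 2 - (s - t) ^ 2 := by nlinarith
    have p₂ : 0 < (s - t) ^ 2 - ν ^ 2 := by nlinarith
    have p₃ : 0 < κ ^ 2 - (s + t) ^ 2 := by nlinarith
    have p₄ : 0 < (s + t) ^ 2 - ν ^ 2 := by nlinarith
    have hκν : 0 < κ ^ 2 - ν ^ 2 := by linarith
    have hlt : (κ ^ 2 - (s + t) ^ 2) * ((s + t) ^ 2 - ν ^ 2)
        < (κ ^ 2 - (s - t) ^ 2) * ((s - t) ^ 2 - ν ^ 2) := by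
      have hst : 0 < 4 * s * t := by nlinarith
      have ht2 : 0 < 2 * s ^ 2 + 2 * t ^ 2 - κ ^ 2 - ν ^ 2 := by nlinarith
      nlinarith [mul_pos hst ht2]
    have e₁ : 1 / (κ ^ 2 - (s - t) ^ 2) + 1 / ((s - t) ^ 2 - ν ^ 2)
        = (κ ^ 2 - ν ^ 2) / ((κ ^ 2 - (s - t) ^ 2) * ((s - t) ^ 2 - ν ^ 2)) := by
      rw [div_add_div _ _ p₁.ne' p₂.ne']
      ring
    have e₂ : 1 / (κ ^ 2 - (s + t) ^ 2) + 1 / ((s + t) ^ 2 - ν ^ 2)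
        = (κ ^ 2 - ν ^ 2) / ((κ ^ 2 - (s + t) ^ 2) * ((s + t) ^ 2 - ν ^ 2)) := by
      rw [div_add_div _ _ p₃.ne' p₄.ne']
      ring
    rw [e₁, e₂]
    linarith [div_lt_div_of_pos_left hκν (mul_pos p₃ p₄) hlt]
  have h := hmono (Set.left_mem_Icc.2 hδ.le) (Set.right_mem_Icc.2 hδ.le) hδ
  simp only [sub_zero, add_zero] at h
  linarith

lemma lt_of_branchGap_add_eq_zero {ν κ s s' δ : ℝ} (hν : 0 ≤ ν) (hδ : 0 < δ)
    (h₁ : ν < s - δ) (h₂ : s + δ < κ) (h₁' : ν < s') (h₂' : s' < κ)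
    (h : branchGap ν κ (s - δ) + branchGap ν κ (s + δ) = 0) (h' : branchGap ν κ s' = 0) :
    s < s' := by
  have hνκ : ν < κ := h₁'.trans h₂'
  set m := √((κ ^ 2 + ν ^ 2) / 2) with hm
  have hmsq : 2 * m ^ 2 = κ ^ 2 + ν ^ 2 := by
    rw [hm, Real.sq_sqrt (by positivity)]
    ring
  have hνm : ν < m := Real.lt_sqrt_of_sq_lt (by nlinarith)
  have hmκ : m < κ := (Real.sqrt_lt' (by linarith)).2 (by nlinarith)
  have hmono := strictMonoOn_branchGap (κ := κ) hν
  have hms' : m ≤ s' := by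
    rw [← hmono.le_iff_le ⟨hνm, hmκ⟩ ⟨h₁', h₂'⟩, h']
    exact branchGap_nonpos_of_sq hν hνm hmκ hmsq
  by_contra! hss
  have hgap : 0 ≤ branchGap ν κ s := by
    rw [← h', hmono.le_iff_le ⟨h₁', h₂'⟩ ⟨by linarith, by linarith⟩]
    exact hss
  have := two_mul_branchGap_lt hν hδ h₁ h₂ (by nlinarith)
  linarith

/-- A root `s` of `β s² - 2 ν coth (ν T) s + ν² = 0`, for `β = 1 - σ²`, determines `T`. -/
lemma two_mul_eq_log_of_quadratic {ν σ s T : ℝ} (hν : 0 < ν) (hs : 0 < s) (hT : 0 < T)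
    (h : (1 - σ ^ 2) * s ^ 2 + ν ^ 2 = 2 * ν * s * coth (ν * T)) :
    2 * (ν * T) = log (((s - σ * s + ν) * (s + σ * s + ν))
      / ((s - σ * s - ν) * (s + σ * s - ν))) := by
  rw [← log_coth_add_one_div_coth_sub_one (mul_pos hν hT)]
  have hc : coth (ν * T) - 1 ≠ 0 := (sub_pos.2 (one_lt_coth_s13 (mul_pos hν hT))).ne'
  have h₁ : (s - σ * s + ν) * (s + σ * s + ν) = (2 * ν * s) * (coth (ν * T) + 1) := by
    linear_combination h
  have h₂ : (s - σ * s - ν) * (s + σ * s - ν) = (2 * ν * s) * (coth (ν * T) - 1) := by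
    linear_combination h
  rw [h₁, h₂, mul_div_mul_left _ _ (by positivity)]

lemma lamS_spec {k : ℕ} (hk : 0 < k) {σ s T : ℝ} (hσ0 : 0 ≤ σ) (hσ1 : σ < 1) (hT : 0 < T)
    (hs : lamS k (1 - σ ^ 2) T = 4 * π * s) :
    s + σ * s < k ∧ T = lowerBranch k (s - σ * s) + lowerBranch k (s + σ * s) := by
  have hk' : (0 : ℝ) < k := by exact_mod_cast hk
  have hβ : 0 < 1 - σ ^ 2 := by nlinarith
  have hc := one_lt_coth_s13 (mul_pos hk' hT)
  rw [lamS] at hs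
  have hquad : 0 ≤ coth (k * T) ^ 2 - (1 - σ ^ 2) := by nlinarith
  have hr := Real.sq_sqrt hquad
  have hr0 := Real.sqrt_nonneg (coth (k * T) ^ 2 - (1 - σ ^ 2))
  set c := coth (k * T)
  set r := √(c ^ 2 - (1 - σ ^ 2))
  have hsβ : (1 - σ ^ 2) * s = k * (c - r) := by
    field_simp at hs
    linarith
  have hrc : r < c := by nlinarith
  have hrl : c - (1 - σ) < r := by nlinarith
  have hs0 : 0 < s := by
    have := mul_pos hk' (sub_pos.2 hrc)
    rw [← hsβ] at this
    exact pos_of_mul_pos_right this hβ.le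
  have hsk : s + σ * s < k := by
    have h : (1 - σ) * (s + σ * s) < (1 - σ) * k := by nlinarith
    exact lt_of_mul_lt_mul_left h (by linarith)
  have hsk' : s - σ * s < k := by nlinarith
  have hpos : 0 < s - σ * s := by nlinarith
  have heq : (1 - σ ^ 2) * s ^ 2 + (k : ℝ) ^ 2 = 2 * k * s * c := by
    apply mul_left_cancel₀ hβ.ne'
    linear_combination ((1 - σ ^ 2) * s + k * (c - r) - 2 * k * c) * hsβ + (k : ℝ) ^ 2 * hr
  have hlog := two_mul_eq_log_of_quadratic hk' hs0 hT heq
  refine ⟨hsk, ?_⟩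
  have hsσ : 0 ≤ σ * s := by positivity
  rw [← neg_mul_neg (s - σ * s - k), neg_sub, neg_sub,
    Real.log_div (by apply mul_ne_zero <;> linarith) (by apply mul_ne_zero <;> linarith),
    Real.log_mul (by linarith) (by linarith), Real.log_mul (by linarith) (by linarith)] at hlog
  rw [lowerBranch, lowerBranch, add_comm (k : ℝ), add_comm (k : ℝ), ← add_div,
    eq_div_iff (by positivity)]
  linarith

lemma muS_spec {l : ℕ} {σ s T : ℝ} (hσ0 : 0 ≤ σ) (hσ1 : σ < 1) (hT : 0 < T)
    (hs : muS l (1 - σ ^ 2) T = 4 * π * s) :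
    l < s - σ * s ∧ T = upperBranch l (s - σ * s) + upperBranch l (s + σ * s) := by
  have hβ : 0 < 1 - σ ^ 2 := by nlinarith
  rw [muS] at hs
  split_ifs at hs with h0
  · subst h0
    have hsT : s * (T * (1 - σ ^ 2)) = 2 := by
      field_simp at hs
      linarith
    have hs0 : 0 < s := by
      have : 0 < s * (T * (1 - σ ^ 2)) := by rw [hsT]; norm_num
      exact pos_of_mul_pos_left this (by positivity)
    have hpos : 0 < s - σ * s := by nlinarith
    have hpos' : 0 < s + σ * s := by positivity
    refine ⟨by simpa using hpos, ?_⟩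
    simp only [upperBranch, Nat.cast_zero, if_true]
    rw [div_add_div _ _ hpos.ne' hpos'.ne', eq_div_iff (by positivity)]
    linear_combination s * hsT
  · have hl' : (0 : ℝ) < l := by exact_mod_cast Nat.pos_of_ne_zero h0
    have hc := one_lt_coth_s13 (mul_pos hl' hT)
    have hquad : 0 ≤ coth (l * T) ^ 2 - (1 - σ ^ 2) := by nlinarith
    have hr := Real.sq_sqrt hquad
    have hr0 := Real.sqrt_nonneg (coth (l * T) ^ 2 - (1 - σ ^ 2))
    set c := coth (l * T)
    set r := √(c ^ 2 - (1 - σ ^ 2))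
    have hsβ : (1 - σ ^ 2) * s = l * (c + r) := by
      field_simp at hs
      linarith
    have hrl : (1 + σ) - c < r := by nlinarith
    have hs0 : 0 < s := by
      have : 0 < l * (c + r) := by positivity
      rw [← hsβ] at this
      exact pos_of_mul_pos_right this hβ.le
    have hsl : l < s - σ * s := by
      have h : (1 + σ) * l < (1 + σ) * (s - σ * s) := by nlinarith
      exact lt_of_mul_lt_mul_left h (by linarith)
    have heq : (1 - σ ^ 2) * s ^ 2 + (l : ℝ) ^ 2 = 2 * l * s * c := by
      apply mul_left_cancel₀ hβ.ne'
      linear_combination ((1 - σ ^ 2) * s + l * (c + r) - 2 * l * c) * hsβ + (l : ℝ) ^ 2 * hr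
    have hlog := two_mul_eq_log_of_quadratic hl' hs0 hT heq
    refine ⟨hsl, ?_⟩
    have hsσ : 0 ≤ σ * s := by positivity
    rw [Real.log_div (by apply mul_ne_zero <;> linarith) (by apply mul_ne_zero <;> linarith),
      Real.log_mul (by linarith) (by linarith), Real.log_mul (by linarith) (by linarith)] at hlog
    rw [upperBranch, upperBranch, if_neg hl'.ne', if_neg hl'.ne', ← add_div,
      eq_div_iff (by positivity)]
    linarith

theorem lam_at_intersection_lt_beta_one (k l : ℕ) (hlk : l < k)
    (α β : ℝ) (hα : 1 < α) (hβ : β = 4 * α / (1 + α) ^ 2)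
    (hcond : 1 ≤ l → α < (k : ℝ) / l)
    (T T' : ℝ) (hT : 0 < T) (hT' : 0 < T')
    (h : lamS k β T = muS l β T) (h' : lamS k 1 T' = muS l 1 T') :
    lamS k β T < lamS k 1 T' := by
  have hk : 0 < k := Nat.zero_lt_of_lt hlk
  obtain ⟨σ, hσ0, hσ1, hσ⟩ : ∃ σ : ℝ, 0 < σ ∧ σ < 1 ∧ β = 1 - σ ^ 2 := by
    refine ⟨(α - 1) / (α + 1), div_pos (by linarith) (by linarith), ?_, ?_⟩
    · rw [div_lt_one (by linarith)]
      linarith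
    · rw [hβ]
      have : α + 1 ≠ 0 := by linarith
      have : 1 + α ≠ 0 := by linarith
      field_simp
      ring
  have hπ : (0 : ℝ) < 4 * π := by positivity
  obtain ⟨s, hs⟩ : ∃ s, lamS k β T = 4 * π * s :=
    ⟨lamS k β T / (4 * π), (mul_div_cancel₀ _ hπ.ne').symm⟩
  obtain ⟨s', hs'⟩ : ∃ s', lamS k 1 T' = 4 * π * s' :=
    ⟨lamS k 1 T' / (4 * π), (mul_div_cancel₀ _ hπ.ne').symm⟩
  have hone : (1 : ℝ) = 1 - 0 ^ 2 := by norm_num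
  obtain ⟨hsk, hTk⟩ := lamS_spec hk hσ0.le hσ1 hT (hσ ▸ hs)
  obtain ⟨hsl, hTl⟩ := muS_spec hσ0.le hσ1 hT (hσ ▸ (h ▸ hs))
  obtain ⟨hsk', hTk'⟩ := lamS_spec hk le_rfl zero_lt_one hT' (hone ▸ hs')
  obtain ⟨hsl', hTl'⟩ := muS_spec le_rfl zero_lt_one hT' (hone ▸ (h' ▸ hs'))
  simp only [zero_mul, add_zero, sub_zero] at hsk' hTk' hsl' hTl'
  rw [hs, hs']
  refine mul_lt_mul_of_pos_left ?_ hπ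
  have hl0 : (0 : ℝ) ≤ l := Nat.cast_nonneg l
  have hs0 : 0 < s := by nlinarith
  refine lt_of_branchGap_add_eq_zero hl0 (mul_pos hσ0 hs0) hsl hsk hsl' hsk' ?_ ?_
  · simp only [branchGap]
    linarith
  · simp only [branchGap]
    linarith
end
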